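/- Both bounds in the inequality c(f) − 3 ≤ ℓ(f) ≤ 4c(f) − 12 are sharp: for every integer n ≥ 1, the element x₁ⁿ of Thompson's group F satisfies ℓ(x₁ⁿ) = c(x₁ⁿ) − 3, and the element wₙ = x₀²(x₁x₀⁻¹)ⁿ x₁⁻¹ (x₀x₁⁻¹)ⁿ x₀⁻¹ satisfies ℓ(wₙ) = 4·c(wₙ) − 12. -/

import Mathlib

noncomputable section

open Set

noncomputable section

open Set

def x0fun : ℝ → ℝ := fun t =>
  if t < 0 then t
  else if t ≤ 1/2 then t / 2
  else if t ≤ 3/4 then t - 1/4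
  else if t ≤ 1 then 2 * t - 1
  else t

def x0inv : ℝ → ℝ := fun t =>
  if t < 0 then t
  else if t ≤ 1/4 then 2 * t
  else if t ≤ 1/2 then t + 1/4
  else if t ≤ 1 then (t + 1) / 2
  else t

/-- The generator `x₀` of Thompson's group `F`, as a permutation of `ℝ`
(the identity outside `[0,1]`). -/
def x0 : Equiv.Perm ℝ where
  toFun := x0fun
  invFun := x0inv
  left_inv := by
    intro t
    show x0inv (x0fun t) = t
    unfold x0fun
    split_ifs <;> (unfold x0inv; split_ifs <;> linarith)
  right_inv := by
    intro t
    show x0fun (x0inv t) = t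
    unfold x0inv
    split_ifs <;> (unfold x0fun; split_ifs <;> linarith)

def x1fun : ℝ → ℝ := fun t =>
  if t < 0 then t
  else if t ≤ 1/2 then t
  else if t ≤ 3/4 then t / 2 + 1/4
  else if t ≤ 7/8 then t - 1/8
  else if t ≤ 1 then 2 * t - 1
  else t

def x1inv : ℝ → ℝ := fun t =>
  if t < 0 then t
  else if t ≤ 1/2 then t
  else if t ≤ 5/8 then 2 * t - 1/2
  else if t ≤ 3/4 then t + 1/8
  else if t ≤ 1 then (t + 1) / 2
  else t

set_option maxHeartbeats 2000000 in
/-- The generator `x₁` of Thompson's group `F`, as a permutation of `ℝ`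
(the identity outside `[0,1]`). -/
def x1 : Equiv.Perm ℝ where
  toFun := x1fun
  invFun := x1inv
  left_inv := by
    intro t
    show x1inv (x1fun t) = t
    unfold x1fun
    split_ifs <;> (unfold x1inv; split_ifs <;> linarith)
  right_inv := by
    intro t
    show x1fun (x1inv t) = t
    unfold x1inv
    split_ifs <;> (unfold x1fun; split_ifs <;> linarith)

/-- Thompson's group `F`: the subgroup generated by `x₀` and `x₁`. -/
def ThompsonF : Subgroup (Equiv.Perm ℝ) :=
  Subgroup.closure ({x0, x1} : Set (Equiv.Perm ℝ))

/-- Word length with respect to the generating set `{x₀, x₁}`. -/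
def wordLength (f : Equiv.Perm ℝ) : ℕ :=
  sInf {n | ∃ w : List (Equiv.Perm ℝ), w.length = n ∧
    (∀ g ∈ w, g ∈ ({x0, x1, x0⁻¹, x1⁻¹} : Set (Equiv.Perm ℝ))) ∧ w.prod = f}
/-- `a` and `b` are the endpoints of a standard dyadic interval `[k/2^m, (k+1)/2^m]`. -/
def IsStdDyadicPair (a b : ℝ) : Prop :=
  ∃ k m : ℕ, a = (k : ℝ) / 2 ^ m ∧ b = ((k : ℝ) + 1) / 2 ^ m

/-- `breakCount f` is `c(f)`: the least `N ≥ 1` such that there are partitions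
`0 = a₀ < ⋯ < a_N = 1` and `0 = b₀ < ⋯ < b_N = 1` of `[0,1]` into standard dyadic
intervals with `f` mapping each `[a_{i−1}, a_i]` affinely (increasingly) onto `[b_{i−1}, b_i]`. -/
def breakCount (f : Equiv.Perm ℝ) : ℕ :=
  sInf {N | 1 ≤ N ∧ ∃ a b : Fin (N + 1) → ℝ,
    a 0 = 0 ∧ a (Fin.last N) = 1 ∧ b 0 = 0 ∧ b (Fin.last N) = 1 ∧
    StrictMono a ∧ StrictMono b ∧
    ∀ i : Fin N, IsStdDyadicPair (a i.castSucc) (a i.succ) ∧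
      IsStdDyadicPair (b i.castSucc) (b i.succ) ∧
      ∃ c d : ℝ, 0 < c ∧ (∀ t ∈ Set.Icc (a i.castSucc) (a i.succ), f t = c * t + d) ∧
        c * a i.castSucc + d = b i.castSucc ∧ c * a i.succ + d = b i.succ}


section Generators

theorem x0_of_le_half {t : ℝ} (h0 : 0 ≤ t) (h1 : t ≤ 1 / 2) : x0 t = t / 2 := by
  change x0fun t = _
  unfold x0fun
  split_ifs <;> linarith

theorem x0_of_mem_middle {t : ℝ} (h0 : 1 / 2 ≤ t) (h1 : t ≤ 3 / 4) : x0 t = t - 1 / 4 := by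
  change x0fun t = _
  unfold x0fun
  split_ifs <;> linarith

theorem x0_of_ge {t : ℝ} (h0 : 3 / 4 ≤ t) (h1 : t ≤ 1) : x0 t = 2 * t - 1 := by
  change x0fun t = _
  unfold x0fun
  split_ifs <;> linarith

theorem x0_inv_of_le {t : ℝ} (h0 : 0 ≤ t) (h1 : t ≤ 1 / 4) : x0⁻¹ t = 2 * t := by
  rw [Equiv.Perm.inv_eq_iff_eq, x0_of_le_half] <;> linarith

theorem x0_inv_of_mem_middle {t : ℝ} (h0 : 1 / 4 ≤ t) (h1 : t ≤ 1 / 2) :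
    x0⁻¹ t = t + 1 / 4 := by
  rw [Equiv.Perm.inv_eq_iff_eq, x0_of_mem_middle] <;> linarith

theorem x0_inv_of_ge_half {t : ℝ} (h0 : 1 / 2 ≤ t) (h1 : t ≤ 1) : x0⁻¹ t = (t + 1) / 2 := by
  rw [Equiv.Perm.inv_eq_iff_eq, x0_of_ge] <;> linarith

theorem x1_of_le_half {t : ℝ} (h1 : t ≤ 1 / 2) : x1 t = t := by
  change x1fun t = _
  unfold x1fun
  split_ifs <;> linarith

theorem x1_of_mem_contracting {t : ℝ} (h0 : 1 / 2 ≤ t) (h1 : t ≤ 3 / 4) :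
    x1 t = t / 2 + 1 / 4 := by
  change x1fun t = _
  unfold x1fun
  split_ifs <;> linarith

theorem x1_of_mem_middle {t : ℝ} (h0 : 3 / 4 ≤ t) (h1 : t ≤ 7 / 8) : x1 t = t - 1 / 8 := by
  change x1fun t = _
  unfold x1fun
  split_ifs <;> linarith

theorem x1_of_ge {t : ℝ} (h0 : 7 / 8 ≤ t) (h1 : t ≤ 1) : x1 t = 2 * t - 1 := by
  change x1fun t = _
  unfold x1fun
  split_ifs <;> linarith

theorem x1_inv_of_le_half {t : ℝ} (h1 : t ≤ 1 / 2) : x1⁻¹ t = t := by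
  rw [Equiv.Perm.inv_eq_iff_eq, x1_of_le_half h1]

theorem x1_inv_of_mem_expanding {t : ℝ} (h0 : 1 / 2 ≤ t) (h1 : t ≤ 5 / 8) :
    x1⁻¹ t = 2 * t - 1 / 2 := by
  rw [Equiv.Perm.inv_eq_iff_eq, x1_of_mem_contracting] <;> linarith

theorem x1_inv_of_mem_middle {t : ℝ} (h0 : 5 / 8 ≤ t) (h1 : t ≤ 3 / 4) :
    x1⁻¹ t = t + 1 / 8 := by
  rw [Equiv.Perm.inv_eq_iff_eq, x1_of_mem_middle] <;> linarith

theorem x1_inv_of_ge {t : ℝ} (h0 : 3 / 4 ≤ t) (h1 : t ≤ 1) : x1⁻¹ t = (t + 1) / 2 := by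
  rw [Equiv.Perm.inv_eq_iff_eq, x1_of_ge] <;> linarith

end Generators

section Line

/-- `x₀` transported to the real line: translation by `-1`. -/
def lineX0 : Equiv.Perm ℝ := Equiv.subRight 1

/-- `x₁` transported to the real line. -/
def lineX1 : Equiv.Perm ℝ where
  toFun t := if t ≤ 0 then t else if t ≤ 2 then t / 2 else t - 1
  invFun t := if t ≤ 0 then t else if t ≤ 1 then 2 * t else t + 1
  left_inv t := by
    dsimp only
    split_ifs <;> linarith
  right_inv t := by
    dsimp only
    split_ifs <;> linarith

theorem lineX0_apply (t : ℝ) : lineX0 t = t - 1 := rfl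

theorem lineX0_inv_apply (t : ℝ) : lineX0⁻¹ t = t + 1 := rfl

theorem lineX1_apply (t : ℝ) :
    lineX1 t = if t ≤ 0 then t else if t ≤ 2 then t / 2 else t - 1 := rfl

theorem lineX1_inv_apply (t : ℝ) :
    lineX1⁻¹ t = if t ≤ 0 then t else if t ≤ 1 then 2 * t else t + 1 := rfl

/-- The piecewise affine homeomorphism from `ℝ` onto `(0, 1)` that conjugates `lineX0`, `lineX1`
to `x0`, `x1`. -/
def toUnit (t : ℝ) : ℝ :=
  if 0 ≤ t then 1 - (2 : ℝ) ^ (-⌊t⌋ - 1) * (1 - Int.fract t / 2)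
  else (2 : ℝ) ^ (⌊t⌋ - 1) * (1 + Int.fract t)

theorem toUnit_intCast_add_of_nonneg {n : ℤ} {r : ℝ} (hn : 0 ≤ n) (h0 : 0 ≤ r) (h1 : r < 1) :
    toUnit (n + r) = 1 - (2 : ℝ) ^ (-n - 1) * (1 - r / 2) := by
  have hf : ⌊(n : ℝ) + r⌋ = n := by
    rw [Int.floor_intCast_add, Int.floor_eq_zero_iff.2 ⟨h0, h1⟩, add_zero]
  have hn' : (0 : ℝ) ≤ n := by exact_mod_cast hn
  rw [toUnit, if_pos (by linarith), Int.fract, hf, add_sub_cancel_left]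

theorem toUnit_intCast_add_of_neg {n : ℤ} {r : ℝ} (hn : n < 0) (h0 : 0 ≤ r) (h1 : r < 1) :
    toUnit (n + r) = (2 : ℝ) ^ (n - 1) * (1 + r) := by
  have hf : ⌊(n : ℝ) + r⌋ = n := by
    rw [Int.floor_intCast_add, Int.floor_eq_zero_iff.2 ⟨h0, h1⟩, add_zero]
  have hn' : (n : ℝ) ≤ -1 := by exact_mod_cast Int.le_sub_one_of_lt hn
  rw [toUnit, if_neg (by linarith), Int.fract, hf, add_sub_cancel_left]

theorem exists_intCast_add (t : ℝ) : ∃ (n : ℤ) (r : ℝ), 0 ≤ r ∧ r < 1 ∧ t = n + r :=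
  ⟨⌊t⌋, Int.fract t, Int.fract_nonneg t, Int.fract_lt_one t, (Int.floor_add_fract t).symm⟩

theorem two_zpow_le {n m : ℤ} (h : n ≤ m) : (2 : ℝ) ^ n ≤ 2 ^ m :=
  zpow_le_zpow_right₀ one_le_two h

theorem toUnit_of_mem_Ico {t : ℝ} (h0 : 0 ≤ t) (h1 : t < 1) : toUnit t = 1 / 2 + t / 4 := by
  have := toUnit_intCast_add_of_nonneg le_rfl h0 h1
  norm_num at this
  linarith

theorem toUnit_zero : toUnit 0 = 1 / 2 := by
  rw [toUnit_of_mem_Ico] <;> norm_num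

theorem toUnit_natCast (n : ℕ) : toUnit n = 1 - (1 / 2) ^ (n + 1) := by
  have := toUnit_intCast_add_of_nonneg (n := n) (r := 0) (by positivity) le_rfl one_pos
  simp only [Int.cast_natCast, add_zero, zero_div, sub_zero, mul_one] at this
  rw [this, show -(n : ℤ) - 1 = -((n + 1 : ℕ) : ℤ) by push_cast; ring, zpow_neg, zpow_natCast,
    one_div, inv_pow]

theorem toUnit_lt_half {t : ℝ} (h : t < 0) : 0 < toUnit t ∧ toUnit t < 1 / 2 := by
  obtain ⟨n, r, h0, h1, rfl⟩ := exists_intCast_add t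
  have hn : n < 0 := by
    have : (n : ℝ) < 0 := by linarith
    exact_mod_cast this
  rw [toUnit_intCast_add_of_neg hn h0 h1]
  have h2 : (2 : ℝ) ^ (n - 1) ≤ 2 ^ (-2 : ℤ) := two_zpow_le (by omega)
  have h3 : (0 : ℝ) < 2 ^ (n - 1) := by positivity
  norm_num at h2
  constructor
  · positivity
  · nlinarith

theorem toUnit_ge_of_one_le {t : ℝ} (h : 1 ≤ t) : 3 / 4 ≤ toUnit t ∧ toUnit t ≤ 1 := by
  obtain ⟨n, r, h0, h1, rfl⟩ := exists_intCast_add t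
  have hn : 1 ≤ n := by
    have : (0 : ℝ) < n := by linarith
    have : 0 < n := by exact_mod_cast this
    omega
  rw [toUnit_intCast_add_of_nonneg (by omega) h0 h1]
  have h2 : (2 : ℝ) ^ (-n - 1) ≤ 2 ^ (-2 : ℤ) := two_zpow_le (by omega)
  have h3 : (0 : ℝ) < 2 ^ (-n - 1) := by positivity
  norm_num at h2
  constructor <;> nlinarith

theorem toUnit_sub_one_of_one_le {t : ℝ} (h : 1 ≤ t) : toUnit (t - 1) = 2 * toUnit t - 1 := by
  obtain ⟨n, r, h0, h1, rfl⟩ := exists_intCast_add t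
  have hn : 1 ≤ n := by
    have : (0 : ℝ) < n := by linarith
    have : 0 < n := by exact_mod_cast this
    omega
  rw [toUnit_intCast_add_of_nonneg (by omega) h0 h1,
    show (n : ℝ) + r - 1 = ((n - 1 : ℤ) : ℝ) + r by push_cast; ring,
    toUnit_intCast_add_of_nonneg (by omega) h0 h1,
    show -(n - 1) - 1 = (-n - 1) + 1 by ring, zpow_add_one₀ two_ne_zero]
  ring

theorem toUnit_sub_one_of_neg {t : ℝ} (h : t < 0) : toUnit (t - 1) = toUnit t / 2 := by
  obtain ⟨n, r, h0, h1, rfl⟩ := exists_intCast_add t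
  have hn : n < 0 := by
    have : (n : ℝ) < 0 := by linarith
    exact_mod_cast this
  rw [toUnit_intCast_add_of_neg hn h0 h1,
    show (n : ℝ) + r - 1 = ((n - 1 : ℤ) : ℝ) + r by push_cast; ring,
    toUnit_intCast_add_of_neg (by omega) h0 h1, zpow_sub_one₀ two_ne_zero (n - 1)]
  ring

theorem toUnit_of_mem_Ico_neg_one {t : ℝ} (h0 : -1 ≤ t) (h1 : t < 0) :
    toUnit t = 1 / 2 + t / 4 := by
  have := toUnit_intCast_add_of_neg (n := -1) (r := t + 1) (by norm_num) (by linarith)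
    (by linarith)
  norm_num at this
  linarith

theorem toUnit_of_mem_Ico_one {t : ℝ} (h0 : 1 ≤ t) (h1 : t < 2) :
    toUnit t = 5 / 8 + t / 8 := by
  have h := toUnit_sub_one_of_one_le h0
  rw [toUnit_of_mem_Ico (by linarith) (by linarith)] at h
  linarith

theorem toUnit_lineX0 (t : ℝ) : toUnit (lineX0 t) = x0 (toUnit t) := by
  rw [lineX0_apply]
  rcases lt_or_ge t 0 with h | h
  · rw [toUnit_sub_one_of_neg h, x0_of_le_half (toUnit_lt_half h).1.le (toUnit_lt_half h).2.le]
  rcases lt_or_ge t 1 with h' | h'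
  · rw [toUnit_of_mem_Ico h h', toUnit_of_mem_Ico_neg_one (by linarith) (by linarith),
      x0_of_mem_middle (by linarith) (by linarith)]
    ring
  · rw [toUnit_sub_one_of_one_le h', x0_of_ge (toUnit_ge_of_one_le h').1
      (toUnit_ge_of_one_le h').2]

theorem toUnit_lineX1 (t : ℝ) : toUnit (lineX1 t) = x1 (toUnit t) := by
  rw [lineX1_apply]
  split_ifs with h h'
  · rcases h.lt_or_eq with h | rfl
    · rw [x1_of_le_half (toUnit_lt_half h).2.le]
    · rw [toUnit_zero, x1_of_le_half le_rfl]
  · rcases h'.lt_or_eq with h' | rfl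
    · rw [toUnit_of_mem_Ico (t := t / 2) (by linarith) (by linarith)]
      rcases lt_or_ge t 1 with h1 | h1
      · rw [toUnit_of_mem_Ico (by linarith) h1, x1_of_mem_contracting (by linarith) (by linarith)]
        ring
      · rw [toUnit_of_mem_Ico_one h1 h', x1_of_mem_middle (by linarith) (by linarith)]
        ring
    · have h1 := toUnit_natCast 1
      have h2 := toUnit_natCast 2
      norm_num at h1 h2
      rw [h2, div_self two_ne_zero, h1, x1_of_ge] <;> norm_num
  · have h1 := toUnit_ge_of_one_le (t := t - 1) (by linarith)
    have h2 := toUnit_ge_of_one_le (t := t) (by linarith)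
    have h3 := toUnit_sub_one_of_one_le (t := t) (by linarith)
    rw [h3, x1_of_ge (by linarith) h2.2]

theorem toUnit_lineX0_zpow (k : ℤ) (t : ℝ) : toUnit ((lineX0 ^ k) t) = (x0 ^ k) (toUnit t) := by
  have h (k : ℕ) : ∀ t, toUnit ((lineX0 ^ k) t) = (x0 ^ k) (toUnit t) := by
    induction k with
    | zero => simp
    | succ k ih => intro t; rw [pow_succ, pow_succ, Equiv.Perm.mul_apply, ih, toUnit_lineX0]; rfl
  obtain ⟨k, rfl | rfl⟩ := k.eq_nat_or_neg
  · simpa using h k t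
  · rw [zpow_neg, zpow_neg, Equiv.Perm.eq_inv_iff_eq, zpow_natCast, zpow_natCast, ← h,
      ← Equiv.Perm.mul_apply, mul_inv_cancel, Equiv.Perm.one_apply]

theorem toUnit_injective : Function.Injective toUnit := by
  intro s t hst
  obtain ⟨n, r, h0, h1, rfl⟩ := exists_intCast_add s
  have hpow (k : ℤ) (t : ℝ) : (lineX0 ^ k) t = t - k := by
    induction k with
    | zero => simp
    | succ k ih =>
      rw [add_comm, zpow_one_add, Equiv.Perm.mul_apply, ih, lineX0_apply]
      push_cast; ring
    | pred k ih =>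
      rw [sub_eq_add_neg, add_comm, zpow_add, Equiv.Perm.mul_apply, ih, zpow_neg_one,
        lineX0_inv_apply]
      push_cast; ring
  have h := congrArg (x0 ^ n) hst
  rw [← toUnit_lineX0_zpow, ← toUnit_lineX0_zpow, hpow, hpow, add_sub_cancel_left,
    toUnit_of_mem_Ico h0 h1] at h
  rcases lt_or_ge (t - n) 0 with h2 | h2
  · linarith [(toUnit_lt_half h2).2]
  rcases lt_or_ge (t - n) 1 with h3 | h3
  · rw [toUnit_of_mem_Ico h2 h3] at h
    linarith
  · linarith [(toUnit_ge_of_one_le h3).1]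

end Line

section Words

/-- The generators of Thompson's group and their inverses. -/
inductive Letter
  | a
  | aInv
  | b
  | bInv

/-- The permutation of `ℝ` supported on `[0, 1]` denoted by a letter. -/
def Letter.toPerm : Letter → Equiv.Perm ℝ
  | .a => x0
  | .aInv => x0⁻¹
  | .b => x1
  | .bInv => x1⁻¹

/-- The permutation of the real line denoted by a letter. -/
def Letter.toLine : Letter → Equiv.Perm ℝ
  | .a => lineX0
  | .aInv => lineX0⁻¹
  | .b => lineX1
  | .bInv => lineX1⁻¹

/-- The only point that a letter moves between the integers and the non-integers
(`b`, `bInv`), or between the nonpositive integers and their complement (`a`, `aInv`). -/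
def Letter.pivot : Letter → ℝ
  | .a => 1
  | .aInv => 0
  | .b => 1
  | .bInv => 1 / 2

/-- The permutation of the real line denoted by a word. -/
def lineProd (l : List Letter) : Equiv.Perm ℝ := (l.map Letter.toLine).prod

theorem lineProd_nil (t : ℝ) : lineProd [] t = t := rfl

theorem lineProd_cons (s : Letter) (l : List Letter) (t : ℝ) :
    lineProd (s :: l) t = s.toLine (lineProd l t) := by
  simp [lineProd]

theorem lineProd_append (u v : List Letter) (t : ℝ) :
    lineProd (u ++ v) t = lineProd u (lineProd v t) := by
  simp [lineProd]

theorem toUnit_toLine (s : Letter) (t : ℝ) : toUnit (s.toLine t) = s.toPerm (toUnit t) := by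
  cases s
  · exact toUnit_lineX0 t
  · simp only [Letter.toLine, Letter.toPerm]
    rw [Equiv.Perm.eq_inv_iff_eq, ← toUnit_lineX0, ← Equiv.Perm.mul_apply, mul_inv_cancel,
      Equiv.Perm.one_apply]
  · exact toUnit_lineX1 t
  · simp only [Letter.toLine, Letter.toPerm]
    rw [Equiv.Perm.eq_inv_iff_eq, ← toUnit_lineX1, ← Equiv.Perm.mul_apply, mul_inv_cancel,
      Equiv.Perm.one_apply]

theorem toUnit_lineProd (l : List Letter) (t : ℝ) :
    toUnit (lineProd l t) = (l.map Letter.toPerm).prod (toUnit t) := by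
  induction l with
  | nil => simp [lineProd]
  | cons s l ih => rw [lineProd_cons, toUnit_toLine, ih]; simp

theorem exists_letters {w : List (Equiv.Perm ℝ)}
    (hw : ∀ g ∈ w, g ∈ ({x0, x1, x0⁻¹, x1⁻¹} : Set (Equiv.Perm ℝ))) :
    ∃ l : List Letter, l.map Letter.toPerm = w := by
  have : w ∈ Set.range (List.map Letter.toPerm) := by
    rw [Set.range_list_map]
    intro g hg
    rcases hw g hg with rfl | rfl | rfl | rfl
    exacts [⟨.a, rfl⟩, ⟨.b, rfl⟩, ⟨.aInv, rfl⟩, ⟨.bInv, rfl⟩]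
  exact this

theorem wordLength_eq {f : Equiv.Perm ℝ} {l : List Letter}
    (hl : (l.map Letter.toPerm).prod = f)
    (hmin : ∀ l' : List Letter, (l'.map Letter.toPerm).prod = f → l.length ≤ l'.length) :
    wordLength f = l.length := by
  have hmem : l.length ∈ {n | ∃ w : List (Equiv.Perm ℝ), w.length = n ∧
      (∀ g ∈ w, g ∈ ({x0, x1, x0⁻¹, x1⁻¹} : Set (Equiv.Perm ℝ))) ∧ w.prod = f} := by
    refine ⟨l.map Letter.toPerm, by simp, ?_, hl⟩
    intro g hg
    obtain ⟨s, -, rfl⟩ := List.mem_map.1 hg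
    cases s <;> simp [Letter.toPerm]
  refine le_antisymm (Nat.sInf_le hmem) (le_csInf ⟨_, hmem⟩ ?_)
  rintro _ ⟨w, rfl, hw, hf⟩
  obtain ⟨l', rfl⟩ := exists_letters hw
  simpa using hmin l' hf

theorem toLine_strictMono (s : Letter) : StrictMono s.toLine := by
  intro x y hxy
  cases s <;>
    simp only [Letter.toLine, lineX0_apply, lineX0_inv_apply, lineX1_apply, lineX1_inv_apply]
  · linarith
  · linarith
  · split_ifs <;> linarith
  · split_ifs <;> linarith

theorem lineProd_strictMono (l : List Letter) : StrictMono (lineProd l) := by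
  induction l with
  | nil => exact strictMono_id
  | cons s l ih =>
    intro x y hxy
    rw [lineProd_cons, lineProd_cons]
    exact toLine_strictMono s (ih hxy)

theorem sub_length_le_lineProd (l : List Letter) (t : ℝ) : t - l.length ≤ lineProd l t := by
  induction l with
  | nil => simp [lineProd_nil]
  | cons s l ih =>
    have h (x : ℝ) : x - 1 ≤ s.toLine x := by
      cases s <;>
        simp only [Letter.toLine, lineX0_apply, lineX0_inv_apply, lineX1_apply, lineX1_inv_apply]
      · linarith
      · linarith
      · split_ifs <;> linarith
      · split_ifs <;> linarith
    rw [lineProd_cons, List.length_cons]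
    push_cast
    linarith [h (lineProd l t)]

open Classical in
/-- The number of occurrences of the letter `c` in a word at which the trajectory of `p` sits at
the pivot of `c`. -/
def hits (c : Letter) (p : ℝ) : List Letter → ℕ
  | [] => 0
  | s :: l => hits c p l + if s = c ∧ lineProd l p = c.pivot then 1 else 0

theorem hits_append (c : Letter) (p : ℝ) (u v : List Letter) :
    hits c p (u ++ v) = hits c p v + hits c (lineProd v p) u := by
  induction u with
  | nil => simp [hits]
  | cons s u ih => rw [List.cons_append, hits, hits, ih, lineProd_append, add_assoc]

/-- The total number of hits over all letters. -/
def totalHits (p : ℝ) (l : List Letter) : ℕ :=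
  hits .a p l + hits .aInv p l + hits .b p l + hits .bInv p l

open Classical in
theorem totalHits_cons (p : ℝ) (s : Letter) (l : List Letter) :
    totalHits p (s :: l) = totalHits p l + if lineProd l p = s.pivot then 1 else 0 := by
  cases s <;> simp [totalHits, hits] <;> ring

theorem sum_totalHits_le {ι : Type*} (I : Finset ι) {f : ι → ℝ} (hf : Set.InjOn f I)
    (l : List Letter) : ∑ i ∈ I, totalHits (f i) l ≤ l.length := by
  classical
  induction l with
  | nil => simp [totalHits, hits]
  | cons s l ih =>
    simp_rw [totalHits_cons]
    rw [Finset.sum_add_distrib, List.length_cons]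
    gcongr
    rw [← Finset.card_filter, Finset.card_le_one]
    intro i hi j hj
    rw [Finset.mem_filter] at hi hj
    exact hf hi.1 hj.1 ((lineProd l).injective (hi.2.trans hj.2.symm))

theorem exists_pivot {c : Letter} {S : Set ℝ}
    (hS : ∀ (s : Letter) (t : ℝ), t ∉ S → s.toLine t ∈ S → s = c ∧ t = c.pivot)
    {p : ℝ} {l : List Letter} (hp : p ∉ S) (hl : lineProd l p ∈ S) :
    ∃ u v, l = u ++ c :: v ∧ lineProd v p = c.pivot := by
  induction l with
  | nil => exact absurd hl hp
  | cons s l ih =>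
    by_cases h : lineProd l p ∈ S
    · obtain ⟨u, v, rfl, hv⟩ := ih h
      exact ⟨s :: u, v, rfl, hv⟩
    · rw [lineProd_cons] at hl
      obtain ⟨rfl, h'⟩ := hS s _ h hl
      exact ⟨[], l, rfl, h'⟩

theorem one_le_hits {c : Letter} {p : ℝ} {l : List Letter}
    (h : ∃ u v, l = u ++ c :: v ∧ lineProd v p = c.pivot) : 1 ≤ hits c p l := by
  obtain ⟨u, v, rfl, hv⟩ := h
  rw [hits_append, hits, if_pos ⟨rfl, hv⟩]
  omega

/-- The integers, as a set of reals. -/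
def integers : Set ℝ := Set.range ((↑) : ℤ → ℝ)

/-- The nonpositive integers, as a set of reals. -/
def nonposIntegers : Set ℝ := {t | t ∈ integers ∧ t ≤ 0}

theorem sub_one_mem_integers {t : ℝ} : t - 1 ∈ integers ↔ t ∈ integers := by
  constructor
  · rintro ⟨k, hk⟩
    exact ⟨k + 1, by push_cast; linarith⟩
  · rintro ⟨k, rfl⟩
    exact ⟨k - 1, by push_cast; ring⟩

theorem add_one_mem_integers {t : ℝ} : t + 1 ∈ integers ↔ t ∈ integers := by
  rw [← sub_one_mem_integers, add_sub_cancel_right]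

theorem intCast_eq_of_lt {k j : ℤ} (h0 : ((j - 1 : ℤ) : ℝ) < k) (h1 : (k : ℝ) < ((j + 1 : ℤ) : ℝ)) :
    k = j := by
  have h0 := Int.cast_lt.1 h0
  have h1 := Int.cast_lt.1 h1
  omega

theorem toLine_mem_integers_of_notMem (s : Letter) (t : ℝ) (ht : t ∉ integers)
    (h : s.toLine t ∈ integers) : s = .bInv ∧ t = Letter.bInv.pivot := by
  cases s <;>
    simp only [Letter.toLine, lineX0_apply, lineX0_inv_apply, lineX1_apply, lineX1_inv_apply] at h
  · exact absurd (sub_one_mem_integers.1 h) ht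
  · exact absurd (add_one_mem_integers.1 h) ht
  · split_ifs at h
    · exact absurd h ht
    · obtain ⟨k, hk⟩ := h
      exact absurd ⟨2 * k, by push_cast; linarith⟩ ht
    · exact absurd (sub_one_mem_integers.1 h) ht
  · split_ifs at h with h0 h1
    · exact absurd h ht
    · obtain ⟨k, hk⟩ := h
      have h2 : t ≠ 1 := fun h2 => ht ⟨1, by simp [h2]⟩
      have h3 : t < 1 := lt_of_le_of_ne h1 h2
      obtain rfl : k = 1 :=
        intCast_eq_of_lt (by push_cast; linarith) (by push_cast; linarith)
      refine ⟨rfl, ?_⟩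
      push_cast at hk
      simp only [Letter.pivot]
      linarith
    · exact absurd (add_one_mem_integers.1 h) ht

theorem toLine_notMem_integers_of_mem (s : Letter) (t : ℝ) (ht : t ∉ integersᶜ)
    (h : s.toLine t ∈ integersᶜ) : s = .b ∧ t = Letter.b.pivot := by
  rw [Set.notMem_compl_iff] at ht
  rw [Set.mem_compl_iff] at h
  cases s <;>
    simp only [Letter.toLine, lineX0_apply, lineX0_inv_apply, lineX1_apply, lineX1_inv_apply] at h
  · exact absurd (sub_one_mem_integers.2 ht) h
  · exact absurd (add_one_mem_integers.2 ht) h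
  · split_ifs at h with h0 h1
    · exact absurd ht h
    · obtain ⟨k, rfl⟩ := ht
      have h2 : (k : ℝ) ≠ 2 := fun h2 => h ⟨1, by simp [h2]⟩
      have h3 : (k : ℝ) < 2 := lt_of_le_of_ne h1 h2
      obtain rfl : k = 1 :=
        intCast_eq_of_lt (by push_cast; linarith) (by push_cast; linarith)
      simp [Letter.pivot]
    · exact absurd (sub_one_mem_integers.2 ht) h
  · split_ifs at h
    · exact absurd ht h
    · obtain ⟨k, rfl⟩ := ht
      exact absurd ⟨2 * k, by push_cast; ring⟩ h
    · exact absurd (add_one_mem_integers.2 ht) h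

theorem toLine_mem_nonposIntegers_of_notMem (s : Letter) (t : ℝ) (ht : t ∉ nonposIntegers)
    (h : s.toLine t ∈ nonposIntegers) : s = .a ∧ t = Letter.a.pivot := by
  obtain ⟨h, hle⟩ := h
  have hpos (h : t ∈ integers) : 0 < t := not_le.1 fun h' => ht ⟨h, h'⟩
  cases s <;>
    simp only [Letter.toLine, lineX0_apply, lineX0_inv_apply, lineX1_apply, lineX1_inv_apply]
      at h hle
  · have h' := sub_one_mem_integers.1 h
    have := hpos h'
    obtain ⟨k, rfl⟩ := h'
    obtain rfl : k = 1 :=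
      intCast_eq_of_lt (by push_cast; linarith) (by push_cast; linarith)
    simp [Letter.pivot]
  · linarith [hpos (add_one_mem_integers.1 h)]
  · split_ifs at h hle
    · linarith [hpos h]
    · linarith
    · linarith
  · split_ifs at h hle
    · linarith [hpos h]
    · linarith
    · linarith

theorem toLine_notMem_nonposIntegers_of_mem (s : Letter) (t : ℝ) (ht : t ∉ nonposIntegersᶜ)
    (h : s.toLine t ∈ nonposIntegersᶜ) : s = .aInv ∧ t = Letter.aInv.pivot := by
  rw [Set.notMem_compl_iff] at ht
  rw [Set.mem_compl_iff] at h
  obtain ⟨ht, h0⟩ := ht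
  have hpos (h' : s.toLine t ∈ integers) : 0 < s.toLine t := not_le.1 fun h'' => h ⟨h', h''⟩
  cases s <;>
    simp only [Letter.toLine, lineX0_apply, lineX0_inv_apply, lineX1_apply, lineX1_inv_apply,
      if_pos h0] at hpos
  · linarith [hpos (sub_one_mem_integers.2 ht)]
  · have := hpos (add_one_mem_integers.2 ht)
    obtain ⟨k, rfl⟩ := ht
    obtain rfl : k = 0 :=
      intCast_eq_of_lt (by push_cast; linarith) (by push_cast; linarith)
    simp [Letter.pivot]
  · linarith [hpos ht]
  · linarith [hpos ht]

theorem one_le_hits_bInv {p : ℝ} {l : List Letter} (hp : p ∉ integers)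
    (h : lineProd l p ∈ integers) : 1 ≤ hits .bInv p l :=
  one_le_hits (exists_pivot toLine_mem_integers_of_notMem hp h)

theorem one_le_hits_b {p : ℝ} {l : List Letter} (hp : p ∈ integers)
    (h : lineProd l p ∉ integers) : 1 ≤ hits .b p l :=
  one_le_hits (exists_pivot toLine_notMem_integers_of_mem (Set.notMem_compl_iff.2 hp) h)

theorem one_le_hits_a {p : ℝ} {l : List Letter} (hp : p ∉ nonposIntegers)
    (h : lineProd l p ∈ nonposIntegers) : 1 ≤ hits .a p l :=
  one_le_hits (exists_pivot toLine_mem_nonposIntegers_of_notMem hp h)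

theorem one_le_hits_aInv {p : ℝ} {l : List Letter} (hp : p ∈ nonposIntegers)
    (h : lineProd l p ∉ nonposIntegers) : 1 ≤ hits .aInv p l :=
  one_le_hits (exists_pivot toLine_notMem_nonposIntegers_of_mem (Set.notMem_compl_iff.2 hp) h)

theorem zero_mem_nonposIntegers : (0 : ℝ) ∈ nonposIntegers := ⟨⟨0, by simp⟩, le_rfl⟩

theorem four_le_totalHits {p : ℝ} {u v : List Letter} (hp : p ∉ integers)
    (hv : lineProd v p = 0) (hq : lineProd (u ++ v) p ∉ integers) :
    4 ≤ totalHits p (u ++ v) := by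
  have h0 := zero_mem_nonposIntegers
  rw [lineProd_append, hv] at hq
  have h1 : 1 ≤ hits .bInv p v := one_le_hits_bInv hp (hv ▸ h0.1)
  have h2 : 1 ≤ hits .a p v := one_le_hits_a (fun h => hp h.1) (hv ▸ h0)
  have h3 : 1 ≤ hits .b 0 u := one_le_hits_b h0.1 hq
  have h4 : 1 ≤ hits .aInv 0 u := one_le_hits_aInv h0 fun h => hq h.1
  simp only [totalHits, hits_append, hv]
  omega

/-- The dyadic point `q` lies to the right of the dyadic point `p`, at a distance that is a
power of two smaller than the mesh on which `p` lies. -/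
def Nested (p q : ℝ) : Prop :=
  ∃ (m m' : ℕ) (k : ℤ), m < m' ∧ p = k / 2 ^ m ∧ q = p + 1 / 2 ^ m'

theorem Nested.notMem_integers {p q : ℝ} (h : Nested p q) : q ∉ integers := by
  obtain ⟨m, m', k, hm, rfl, rfl⟩ := h
  rintro ⟨j, hj⟩
  obtain ⟨d, rfl⟩ := Nat.exists_eq_add_of_lt hm
  have h2 : (0 : ℝ) < 2 ^ m := by positivity
  have h3 : (0 : ℝ) < 2 ^ (d + 1) := by positivity
  rw [add_assoc, pow_add] at hj
  field_simp at hj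
  have h4 : (j * 2 ^ m - k) * 2 ^ (d + 1) = 1 := by
    have : ((j : ℝ) * 2 ^ m - k) * 2 ^ (d + 1) = 1 := by linarith
    exact_mod_cast this
  have h5 : (2 : ℤ) ∣ 1 := h4 ▸ Dvd.dvd.mul_left (dvd_pow_self 2 (by omega)) _
  omega

theorem Nested.le_of_lt {p q : ℝ} (h : Nested p q) {j : ℤ} (hj : p < j) : q ≤ j := by
  obtain ⟨m, m', k, hm, rfl, rfl⟩ := h
  have h2 : (0 : ℝ) < 2 ^ m := by positivity
  rw [div_lt_iff₀ h2] at hj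
  have h3 : k + 1 ≤ j * 2 ^ m := by
    have : k < j * 2 ^ m := by exact_mod_cast hj
    omega
  have h4 : (k : ℝ) + 1 ≤ j * 2 ^ m := by exact_mod_cast h3
  have h5 : (1 : ℝ) / 2 ^ m' ≤ 1 / 2 ^ m :=
    one_div_le_one_div_of_le h2 (pow_le_pow_right₀ one_le_two hm.le)
  calc (k : ℝ) / 2 ^ m + 1 / 2 ^ m' ≤ (k + 1) / 2 ^ m := by rw [add_div]; linarith
    _ ≤ j := by rw [div_le_iff₀ h2]; exact h4

theorem Nested.lt {p q : ℝ} (h : Nested p q) : p < q := by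
  obtain ⟨m, m', k, hm, rfl, rfl⟩ := h
  have : (0 : ℝ) < 1 / 2 ^ m' := by positivity
  linarith

theorem Nested.add_int {p q : ℝ} (h : Nested p q) (j : ℤ) : Nested (p + j) (q + j) := by
  obtain ⟨m, m', k, hm, rfl, rfl⟩ := h
  refine ⟨m, m', k + j * 2 ^ m, hm, ?_, by ring⟩
  push_cast
  field_simp

theorem Nested.half {p q : ℝ} (h : Nested p q) : Nested (p / 2) (q / 2) := by
  obtain ⟨m, m', k, hm, rfl, rfl⟩ := h
  refine ⟨m + 1, m' + 1, k, by omega, ?_, ?_⟩ <;> rw [pow_succ] <;> field_simp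

theorem Nested.two_mul {p q : ℝ} (h : Nested p q) (hp : p ∉ integers) :
    Nested (2 * p) (2 * q) := by
  obtain ⟨m, m', k, hm, rfl, rfl⟩ := h
  rcases m with _ | m
  · exact absurd ⟨k, by simp⟩ hp
  obtain ⟨m', rfl⟩ : ∃ d, m' = d + 1 := ⟨m' - 1, by omega⟩
  refine ⟨m, m', k, by omega, ?_, ?_⟩ <;> simp only [pow_succ] <;> field_simp

theorem Nested.toLine {p q : ℝ} (h : Nested p q) (hp : p ≠ 0) (s : Letter) :
    Nested (s.toLine p) (s.toLine q) := by
  have hlt := h.lt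
  have hsub : Nested (p - 1) (q - 1) := by simpa [sub_eq_add_neg] using h.add_int (-1)
  have hadd : Nested (p + 1) (q + 1) := by simpa using h.add_int 1
  have h0 : p < 0 → q ≤ 0 := fun h' => by simpa using h.le_of_lt (j := 0) (by simpa using h')
  cases s <;>
    simp only [Letter.toLine, lineX0_apply, lineX0_inv_apply, lineX1_apply, lineX1_inv_apply]
  · exact hsub
  · exact hadd
  · have h2 : p < 2 → q ≤ 2 := fun h' => by simpa using h.le_of_lt (j := 2) (by simpa using h')
    rcases lt_trichotomy p 0 with hp0 | hp0 | hp0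
    · rwa [if_pos hp0.le, if_pos (h0 hp0)]
    · exact absurd hp0 hp
    · rw [if_neg (not_le.2 hp0), if_neg (not_le.2 (hp0.trans hlt))]
      rcases lt_trichotomy p 2 with hp2 | rfl | hp2
      · rw [if_pos hp2.le, if_pos (h2 hp2)]
        exact h.half
      · rw [if_pos le_rfl, if_neg (by linarith)]
        norm_num at hsub ⊢
        exact hsub
      · rwa [if_neg (by linarith), if_neg (by linarith)]
  · have h1 : p < 1 → q ≤ 1 := fun h' => by simpa using h.le_of_lt (j := 1) (by simpa using h')
    rcases lt_trichotomy p 0 with hp0 | hp0 | hp0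
    · rwa [if_pos hp0.le, if_pos (h0 hp0)]
    · exact absurd hp0 hp
    · rw [if_neg (not_le.2 hp0), if_neg (not_le.2 (hp0.trans hlt))]
      rcases lt_trichotomy p 1 with hp1 | rfl | hp1
      · rw [if_pos hp1.le, if_pos (h1 hp1)]
        refine h.two_mul ?_
        rintro ⟨k, rfl⟩
        have h3 := Int.cast_pos.1 hp0
        have h4 : k < 1 := by exact_mod_cast hp1
        omega
      · rw [if_pos le_rfl, if_neg (by linarith)]
        norm_num at hadd ⊢
        exact hadd
      · rwa [if_neg (by linarith), if_neg (by linarith)]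

theorem Nested.exists_eq_zero {p q : ℝ} (h : Nested p q) {l : List Letter}
    (hl : ∃ u v, l = u ++ v ∧ lineProd v q ∈ integers) :
    ∃ u v, l = u ++ v ∧ lineProd v p = 0 := by
  obtain ⟨u, v, rfl, hv⟩ := hl
  suffices H : ∃ u' v', v = u' ++ v' ∧ lineProd v' p = 0 by
    obtain ⟨u', v', rfl, hv'⟩ := H
    exact ⟨u ++ u', v', by simp, hv'⟩
  have key : ∀ v : List Letter, ¬ Nested (lineProd v p) (lineProd v q) →
      ∃ u' v', v = u' ++ v' ∧ lineProd v' p = 0 := by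
    intro v
    induction v with
    | nil => exact fun h' => absurd h h'
    | cons s v ih =>
      intro h'
      by_cases hN : Nested (lineProd v p) (lineProd v q)
      · refine ⟨[s], v, rfl, ?_⟩
        by_contra h0
        rw [lineProd_cons, lineProd_cons] at h'
        exact h' (hN.toLine h0 s)
      · obtain ⟨u', v', rfl, hv'⟩ := ih hN
        exact ⟨s :: u', v', rfl, hv'⟩
  exact key v fun h' => h'.notMem_integers hv

theorem nested_neg_half_pow (j : ℕ) :
    Nested (-(1 / 2) ^ (j + 1)) (-(1 / 2) ^ (j + 2)) := by
  refine ⟨j + 1, j + 2, -1, by omega, ?_, ?_⟩ <;> simp [pow_succ] <;> ring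

theorem neg_half_pow_notMem_integers (j : ℕ) : -(1 / 2 : ℝ) ^ (j + 1) ∉ integers := by
  have h : Nested (-1 : ℝ) (-1 + 1 / 2 ^ (j + 1)) := ⟨0, j + 1, -1, by omega, by simp, rfl⟩
  rintro ⟨k, hk⟩
  refine h.notMem_integers ⟨-1 - k, ?_⟩
  push_cast
  rw [hk, one_div_pow]
  ring

theorem neg_one_sub_half_pow_notMem_integers (j : ℕ) :
    -1 - (1 / 2 : ℝ) ^ (j + 1) ∉ integers := by
  have h := neg_half_pow_notMem_integers j
  rw [← sub_one_mem_integers] at h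
  rwa [show -1 - (1 / 2 : ℝ) ^ (j + 1) = -(1 / 2 : ℝ) ^ (j + 1) - 1 by ring]

/-- A word whose action fixes `0`, sends `-2⁻ⁿ⁻¹` to `-1` and translates `-2⁻ʲ` by `-1` for
`1 ≤ j ≤ n` has length at least `4n + 4`. -/
theorem four_mul_add_four_le_length {n : ℕ} {l : List Letter} (h0 : lineProd l 0 = 0)
    (h1 : lineProd l (-(1 / 2) ^ (n + 1)) = -1)
    (h2 : ∀ j < n, lineProd l (-(1 / 2) ^ (j + 1)) = -1 - (1 / 2) ^ (j + 1)) :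
    4 * n + 4 ≤ l.length := by
  have hneg : (-1 : ℝ) ∈ nonposIntegers := ⟨⟨-1, by simp⟩, by norm_num⟩
  have hint : ∀ i ≤ n, ∃ u v, l = u ++ v ∧
      lineProd v (-(1 / 2) ^ (n - i + 1)) ∈ integers := by
    intro i hi
    induction i with
    | zero => exact ⟨[], l, rfl, by rw [Nat.sub_zero, h1]; exact hneg.1⟩
    | succ i ih =>
      have hN := nested_neg_half_pow (n - (i + 1))
      rw [show n - (i + 1) + 2 = n - i + 1 by omega] at hN
      obtain ⟨u, v, hl, hv⟩ := hN.exists_eq_zero (ih (by omega))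
      exact ⟨u, v, hl, hv ▸ zero_mem_nonposIntegers.1⟩
  have hmid (j : ℕ) (hj : j < n) : 4 ≤ totalHits (-(1 / 2) ^ (j + 1)) l := by
    have hq := hint (n - (j + 1)) (by omega)
    rw [show n - (n - (j + 1)) + 1 = j + 2 by omega] at hq
    obtain ⟨u, v, rfl, hv⟩ := (nested_neg_half_pow j).exists_eq_zero hq
    refine four_le_totalHits (neg_half_pow_notMem_integers j) hv ?_
    rw [h2 j hj]
    exact neg_one_sub_half_pow_notMem_integers j
  have hlast : 2 ≤ totalHits (-(1 / 2) ^ (n + 1)) l := by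
    have hp := neg_half_pow_notMem_integers n
    have h3 := one_le_hits_bInv hp (l := l) (by rw [h1]; exact hneg.1)
    have h4 := one_le_hits_a (fun h => hp h.1) (l := l) (by rw [h1]; exact hneg)
    unfold totalHits
    omega
  have hzero : 2 ≤ totalHits 0 l := by
    obtain ⟨u, v, rfl, hv⟩ := exists_pivot (l := l) toLine_mem_integers_of_notMem
      (neg_half_pow_notMem_integers n) (by rw [h1]; exact hneg.1)
    have hpos : 0 < lineProd v 0 := by
      have := lineProd_strictMono v (show -(1 / 2 : ℝ) ^ (n + 1) < 0 by simp)
      rw [hv] at this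
      simp only [Letter.pivot] at this
      linarith
    have hout : lineProd v 0 ∉ nonposIntegers := fun h => absurd h.2 (not_le.2 hpos)
    have h3 := one_le_hits_aInv zero_mem_nonposIntegers hout
    rw [← List.singleton_append, ← List.append_assoc] at h0 ⊢
    have h4 := one_le_hits_a (l := u ++ [Letter.bInv]) hout
      (by rw [← lineProd_append, h0]; exact zero_mem_nonposIntegers)
    simp only [totalHits, hits_append _ _ _ v]
    omega
  have hinj : Function.Injective fun i : ℕ => if i = 0 then (0 : ℝ) else -(1 / 2) ^ i := by
    have hpow (i : ℕ) : (1 / 2 : ℝ) ^ i ≠ 0 := by positivity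
    intro i j hij
    dsimp only at hij
    split_ifs at hij with hi hj hj
    · rw [hi, hj]
    · exact absurd (neg_eq_zero.1 hij.symm) (hpow j)
    · exact absurd (neg_eq_zero.1 hij) (hpow i)
    · exact pow_right_injective₀ (by norm_num) (by norm_num) (neg_inj.1 hij)
  have hsum := sum_totalHits_le (Finset.range (n + 2)) hinj.injOn l
  rw [Finset.sum_range_succ', Finset.sum_range_succ] at hsum
  simp only [Nat.add_eq_zero_iff, one_ne_zero, and_false, if_false, if_true] at hsum
  have hle : ∑ _j ∈ Finset.range n, 4 ≤
      ∑ j ∈ Finset.range n, totalHits (-(1 / 2) ^ (j + 1)) l :=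
    Finset.sum_le_sum fun j hj => hmid j (Finset.mem_range.1 hj)
  rw [Finset.sum_const, Finset.card_range, smul_eq_mul] at hle
  omega

end Words

section Formulas

theorem x1_pow_succ_apply (n : ℕ) (t : ℝ) : (x1 ^ (n + 1)) t = (x1 ^ n) (x1 t) := by
  rw [pow_succ, Equiv.Perm.mul_apply]

theorem x1_pow_of_le_half (n : ℕ) {t : ℝ} (h : t ≤ 1 / 2) : (x1 ^ n) t = t := by
  induction n with
  | zero => simp
  | succ n ih => rw [x1_pow_succ_apply, x1_of_le_half h, ih]

theorem x1_pow_of_mem_contracting (n : ℕ) {t : ℝ} (h0 : 1 / 2 ≤ t) (h1 : t ≤ 3 / 4) :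
    (x1 ^ n) t = 1 / 2 + (1 / 2) ^ n * (t - 1 / 2) := by
  induction n generalizing t with
  | zero => simp
  | succ n ih =>
    rw [x1_pow_succ_apply, x1_of_mem_contracting h0 h1, ih (by linarith) (by linarith), pow_succ]
    ring

theorem half_pow_le_half_pow {m n : ℕ} (h : m ≤ n) : (1 / 2 : ℝ) ^ n ≤ (1 / 2) ^ m :=
  pow_le_pow_of_le_one (by norm_num) (by norm_num) h

theorem x1_pow_of_mem_middle (d k : ℕ) {t : ℝ} (h0 : 1 - (1 / 2) ^ (k + 2) ≤ t)
    (h1 : t ≤ 1 - (1 / 2) ^ (k + 3)) :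
    (x1 ^ (d + 1 + k)) t =
      1 / 2 + (1 / 2) ^ (d + 3) + 2 ^ k * (1 / 2) ^ d * (t - (1 - (1 / 2) ^ (k + 2))) := by
  induction k generalizing t with
  | zero =>
    norm_num at h0 h1
    rw [add_zero, x1_pow_succ_apply, x1_of_mem_middle (by linarith) (by linarith),
      x1_pow_of_mem_contracting d (by linarith) (by linarith)]
    ring
  | succ k ih =>
    have h2 : (1 / 2 : ℝ) ^ (k + 1 + 2) = (1 / 2) ^ (k + 2) / 2 := by ring
    have h3 : (1 / 2 : ℝ) ^ (k + 1 + 3) = (1 / 2) ^ (k + 3) / 2 := by ring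
    have h4 : (1 / 2 : ℝ) ^ (k + 2) ≤ (1 / 2) ^ 2 := half_pow_le_half_pow (by omega)
    have h5 : (0 : ℝ) < (1 / 2) ^ (k + 3) := by positivity
    norm_num at h4
    rw [h2] at h0
    rw [h3] at h1
    rw [← add_assoc, x1_pow_succ_apply, x1_of_ge (by linarith) (by linarith),
      ih (by linarith) (by linarith), h2, pow_succ 2 k]
    ring

theorem x1_pow_of_ge (n : ℕ) {t : ℝ} (h0 : 1 - (1 / 2) ^ (n + 2) ≤ t) (h1 : t ≤ 1) :
    (x1 ^ n) t = 1 - 2 ^ n * (1 - t) := by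
  induction n generalizing t with
  | zero => simp
  | succ n ih =>
    have h2 : (1 / 2 : ℝ) ^ (n + 1 + 2) = (1 / 2) ^ (n + 2) / 2 := by ring
    have h4 : (1 / 2 : ℝ) ^ (n + 2) ≤ (1 / 2) ^ 2 := half_pow_le_half_pow (by omega)
    norm_num at h4
    rw [h2] at h0
    rw [x1_pow_succ_apply, x1_of_ge (by linarith) h1, ih (by linarith) (by linarith), pow_succ]
    ring

theorem x1_mul_x0_inv_of_mem_middle {t : ℝ} (h0 : 1 / 4 ≤ t) (h1 : t ≤ 3 / 4) :
    (x1 * x0⁻¹) t = t / 2 + 3 / 8 := by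
  rw [Equiv.Perm.mul_apply]
  rcases le_total t (1 / 2) with h | h
  · rw [x0_inv_of_mem_middle h0 h, x1_of_mem_contracting (by linarith) (by linarith)]
    ring
  · rw [x0_inv_of_ge_half h (by linarith), x1_of_mem_middle (by linarith) (by linarith)]
    ring

theorem x1_mul_x0_inv_of_ge {t : ℝ} (h0 : 3 / 4 ≤ t) (h1 : t ≤ 1) : (x1 * x0⁻¹) t = t := by
  rw [Equiv.Perm.mul_apply, x0_inv_of_ge_half (by linarith) h1,
    x1_of_ge (by linarith) (by linarith)]
  ring

theorem x0_mul_x1_inv_of_le_half {t : ℝ} (h0 : 0 ≤ t) (h1 : t ≤ 1 / 2) :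
    (x0 * x1⁻¹) t = t / 2 := by
  rw [Equiv.Perm.mul_apply, x1_inv_of_le_half h1, x0_of_le_half h0 h1]

theorem x0_mul_x1_inv_of_mem_middle {t : ℝ} (h0 : 1 / 2 ≤ t) (h1 : t ≤ 3 / 4) :
    (x0 * x1⁻¹) t = 2 * t - 3 / 4 := by
  rw [Equiv.Perm.mul_apply]
  rcases le_total t (5 / 8) with h | h
  · rw [x1_inv_of_mem_expanding h0 h, x0_of_mem_middle (by linarith) (by linarith)]
    ring
  · rw [x1_inv_of_mem_middle h h1, x0_of_ge (by linarith) (by linarith)]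
    ring

theorem x0_mul_x1_inv_of_ge {t : ℝ} (h0 : 3 / 4 ≤ t) (h1 : t ≤ 1) : (x0 * x1⁻¹) t = t := by
  rw [Equiv.Perm.mul_apply, x1_inv_of_ge h0 h1, x0_of_ge (by linarith) (by linarith)]
  ring

/-- The conjugate of `x₁⁻¹` by `(x₁x₀⁻¹)ⁿ`. -/
def conjX1Inv (n : ℕ) : Equiv.Perm ℝ := (x1 * x0⁻¹) ^ n * x1⁻¹ * (x0 * x1⁻¹) ^ n

theorem conjX1Inv_zero : conjX1Inv 0 = x1⁻¹ := by simp [conjX1Inv]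

theorem conjX1Inv_succ (n : ℕ) (t : ℝ) :
    conjX1Inv (n + 1) t = (x1 * x0⁻¹) (conjX1Inv n ((x0 * x1⁻¹) t)) := by
  rw [conjX1Inv, pow_succ', pow_succ (x0 * x1⁻¹), ← Equiv.Perm.mul_apply, ← Equiv.Perm.mul_apply,
    conjX1Inv]
  simp only [mul_assoc]

theorem conjX1Inv_of_le (n : ℕ) {t : ℝ} (h0 : 0 ≤ t) (h1 : t ≤ 3 / 4 - (1 / 2) ^ (n + 2)) :
    conjX1Inv n t = t := by
  induction n generalizing t with
  | zero => rw [conjX1Inv_zero, x1_inv_of_le_half (by norm_num at h1; linarith)]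
  | succ n ih =>
    have h2 : (1 / 2 : ℝ) ^ (n + 1 + 2) = (1 / 2) ^ (n + 2) / 2 := by ring
    have h3 : (1 / 2 : ℝ) ^ (n + 2) ≤ (1 / 2) ^ 2 := half_pow_le_half_pow (by omega)
    have h4 : (0 : ℝ) < (1 / 2) ^ (n + 2) := by positivity
    norm_num at h3
    rw [h2] at h1
    have hfix : conjX1Inv n ((x0 * x1⁻¹) t) = (x0 * x1⁻¹) t := by
      rcases le_total t (1 / 2) with h | h
      · rw [x0_mul_x1_inv_of_le_half h0 h]
        exact ih (by linarith) (by linarith)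
      · rw [x0_mul_x1_inv_of_mem_middle h (by linarith)]
        exact ih (by linarith) (by linarith)
    rw [conjX1Inv_succ, hfix, ← Equiv.Perm.mul_apply]
    simp

theorem conjX1Inv_of_mem_expanding (n : ℕ) {t : ℝ} (h0 : 3 / 4 - (1 / 2) ^ (n + 2) ≤ t)
    (h1 : t ≤ 3 / 4 - (1 / 2) ^ (n + 3)) :
    conjX1Inv n t = 3 / 4 - 2 * (3 / 4 - t) + (1 / 2) ^ (n + 2) := by
  induction n generalizing t with
  | zero =>
    norm_num at h0 h1
    rw [conjX1Inv_zero, x1_inv_of_mem_expanding h0 h1]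
    ring
  | succ n ih =>
    have h2 : (1 / 2 : ℝ) ^ (n + 1 + 2) = (1 / 2) ^ (n + 2) / 2 := by ring
    have h2' : (1 / 2 : ℝ) ^ (n + 1 + 3) = (1 / 2) ^ (n + 2) / 4 := by ring
    have h2'' : (1 / 2 : ℝ) ^ (n + 3) = (1 / 2) ^ (n + 2) / 2 := by ring
    have h3 : (1 / 2 : ℝ) ^ (n + 2) ≤ (1 / 2) ^ 2 := half_pow_le_half_pow (by omega)
    have h4 : (0 : ℝ) < (1 / 2) ^ (n + 2) := by positivity
    norm_num at h3
    rw [h2] at h0 ⊢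
    rw [h2'] at h1
    rw [conjX1Inv_succ, x0_mul_x1_inv_of_mem_middle (by linarith) (by linarith),
      ih (by linarith) (by linarith), x1_mul_x0_inv_of_mem_middle (by linarith) (by linarith)]
    ring

theorem two_pow_mul_le {n k : ℕ} {s : ℝ} (h : s ≤ (1 / 2) ^ (n + k)) :
    2 ^ n * s ≤ (1 / 2) ^ k := by
  calc (2 : ℝ) ^ n * s ≤ 2 ^ n * (1 / 2) ^ (n + k) := by gcongr
    _ = (2 * (1 / 2)) ^ n * (1 / 2) ^ k := by rw [mul_pow, pow_add]; ring
    _ = (1 / 2) ^ k := by norm_num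

theorem conjX1Inv_of_mem_steep (n : ℕ) {t : ℝ} (h0 : 3 / 4 - (1 / 2) ^ (n + 3) ≤ t)
    (h1 : t ≤ 3 / 4) : conjX1Inv n t = 7 / 8 - 2 ^ n * (3 / 4 - t) := by
  induction n generalizing t with
  | zero =>
    norm_num at h0
    rw [conjX1Inv_zero, x1_inv_of_mem_middle h0 h1]
    ring
  | succ n ih =>
    have h2 : (1 / 2 : ℝ) ^ (n + 1 + 3) = (1 / 2) ^ (n + 3) / 2 := by ring
    have h3 : (1 / 2 : ℝ) ^ (n + 3) ≤ (1 / 2) ^ 3 := half_pow_le_half_pow (by omega)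
    have h4 := two_pow_mul_le (n := n + 1) (k := 3) (s := 3 / 4 - t) (by linarith)
    have h5 : 0 ≤ 2 ^ (n + 1) * (3 / 4 - t) := mul_nonneg (by positivity) (by linarith)
    norm_num at h3 h4
    rw [h2] at h0
    have h6 : 7 / 8 - 2 ^ n * (3 / 4 - (2 * t - 3 / 4)) = 7 / 8 - 2 ^ (n + 1) * (3 / 4 - t) := by
      ring
    rw [conjX1Inv_succ, x0_mul_x1_inv_of_mem_middle (by linarith) h1,
      ih (by linarith) (by linarith), h6, x1_mul_x0_inv_of_ge (by linarith) (by linarith)]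

theorem conjX1Inv_of_ge (n : ℕ) {t : ℝ} (h0 : 3 / 4 ≤ t) (h1 : t ≤ 1) :
    conjX1Inv n t = (t + 1) / 2 := by
  induction n with
  | zero => rw [conjX1Inv_zero, x1_inv_of_ge h0 h1]
  | succ n ih =>
    rw [conjX1Inv_succ, x0_mul_x1_inv_of_ge h0 h1, ih,
      x1_mul_x0_inv_of_ge (by linarith) (by linarith)]

/-- The elements `wₙ = x₀²(x₁x₀⁻¹)ⁿx₁⁻¹(x₀x₁⁻¹)ⁿx₀⁻¹`. -/
def longElement (n : ℕ) : Equiv.Perm ℝ :=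
  x0 ^ 2 * (x1 * x0⁻¹) ^ n * x1⁻¹ * (x0 * x1⁻¹) ^ n * x0⁻¹

theorem longElement_apply (n : ℕ) (t : ℝ) :
    longElement n t = x0 (x0 (conjX1Inv n (x0⁻¹ t))) := by
  simp only [longElement, conjX1Inv, pow_two, Equiv.Perm.mul_apply]

theorem longElement_of_le (n : ℕ) {t : ℝ} (h0 : 0 ≤ t) (h1 : t ≤ 1 / 2 - (1 / 2) ^ (n + 2)) :
    longElement n t = t / 2 := by
  have h3 : (1 / 2 : ℝ) ^ (n + 2) ≤ (1 / 2) ^ 2 := half_pow_le_half_pow (by omega)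
  have h4 : (0 : ℝ) < (1 / 2) ^ (n + 2) := by positivity
  norm_num at h3
  have hfix : conjX1Inv n (x0⁻¹ t) = x0⁻¹ t := by
    rcases le_total t (1 / 4) with h | h
    · rw [x0_inv_of_le h0 h]
      exact conjX1Inv_of_le n (by linarith) (by linarith)
    · rw [x0_inv_of_mem_middle h (by linarith)]
      exact conjX1Inv_of_le n (by linarith) (by linarith)
  rw [longElement_apply, hfix, ← Equiv.Perm.mul_apply x0 x0⁻¹, mul_inv_cancel,
    Equiv.Perm.one_apply, x0_of_le_half h0 (by linarith)]

theorem longElement_of_mem_isometric (n : ℕ) {t : ℝ} (h0 : 1 / 2 - (1 / 2) ^ (n + 2) ≤ t)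
    (h1 : t ≤ 1 / 2 - (1 / 2) ^ (n + 3)) :
    longElement n t = t - 1 / 4 + (1 / 2) ^ (n + 3) := by
  have h2 : (1 / 2 : ℝ) ^ (n + 3) = (1 / 2) ^ (n + 2) / 2 := by ring
  have h3 : (1 / 2 : ℝ) ^ (n + 2) ≤ (1 / 2) ^ 2 := half_pow_le_half_pow (by omega)
  have h4 : (0 : ℝ) < (1 / 2) ^ (n + 2) := by positivity
  norm_num at h3
  rw [longElement_apply, x0_inv_of_mem_middle (by linarith) (by linarith),
    conjX1Inv_of_mem_expanding n (by linarith) (by linarith),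
    x0_of_mem_middle (t := 3 / 4 - 2 * (3 / 4 - (t + 1 / 4)) + (1 / 2) ^ (n + 2)) (by linarith)
      (by linarith), x0_of_le_half (by linarith) (by linarith)]
  linarith

theorem longElement_of_mem_steep (n : ℕ) {t : ℝ} (h0 : 1 / 2 - (1 / 2) ^ (n + 3) ≤ t)
    (h1 : t ≤ 1 / 2) : longElement n t = 1 / 2 - 2 ^ (n + 1) * (1 / 2 - t) := by
  have h3 : (1 / 2 : ℝ) ^ (n + 3) ≤ (1 / 2) ^ 3 := half_pow_le_half_pow (by omega)
  have h4 := two_pow_mul_le (n := n) (k := 3) (s := 1 / 2 - t) (by linarith)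
  have h5 : 0 ≤ 2 ^ n * (1 / 2 - t) := mul_nonneg (by positivity) (by linarith)
  have h6 : 3 / 4 - (t + 1 / 4) = 1 / 2 - t := by ring
  norm_num at h3 h4
  rw [longElement_apply, x0_inv_of_mem_middle (by linarith) h1,
    conjX1Inv_of_mem_steep n (by linarith) (by linarith), h6,
    x0_of_ge (t := 7 / 8 - 2 ^ n * (1 / 2 - t)) (by linarith) (by linarith),
    x0_of_mem_middle (by linarith) (by linarith), pow_succ]
  ring

theorem longElement_of_ge_half (n : ℕ) {t : ℝ} (h0 : 1 / 2 ≤ t) (h1 : t ≤ 1) :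
    longElement n t = t := by
  rw [longElement_apply, x0_inv_of_ge_half h0 h1, conjX1Inv_of_ge n (by linarith) (by linarith),
    x0_of_ge (t := ((t + 1) / 2 + 1) / 2) (by linarith) (by linarith),
    x0_of_ge (by linarith) (by linarith)]
  ring

end Formulas

section BreakCount

theorem IsStdDyadicPair.lt {a b : ℝ} (h : IsStdDyadicPair a b) : a < b := by
  obtain ⟨k, m, rfl, rfl⟩ := h
  gcongr
  linarith

theorem IsStdDyadicPair.half {a b : ℝ} (h : IsStdDyadicPair a b) :
    IsStdDyadicPair (a / 2) (b / 2) := by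
  obtain ⟨k, m, rfl, rfl⟩ := h
  exact ⟨k, m + 1, by rw [pow_succ, div_div], by rw [pow_succ, div_div]⟩

theorem isStdDyadicPair_one_sub (i : ℕ) :
    IsStdDyadicPair (1 - (1 / 2) ^ i) (1 - (1 / 2) ^ (i + 1)) := by
  have h : 2 ≤ 2 ^ (i + 1) := by
    rw [pow_succ]
    have := Nat.one_le_two_pow (n := i)
    omega
  refine ⟨2 ^ (i + 1) - 2, i + 1, ?_, ?_⟩ <;> push_cast [h] <;>
    simp only [one_div, inv_pow, pow_succ] <;> field_simp <;> ring

theorem isStdDyadicPair_one_sub_one (i : ℕ) : IsStdDyadicPair (1 - (1 / 2) ^ i) 1 := by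
  refine ⟨2 ^ i - 1, i, ?_, ?_⟩ <;> push_cast [Nat.one_le_two_pow]
  · rw [one_div_pow]
    field_simp
  · field_simp
    ring

theorem isStdDyadicPair_half_add (j : ℕ) :
    IsStdDyadicPair (1 / 2 + (1 / 2) ^ (j + 1)) (1 / 2 + (1 / 2) ^ j) := by
  refine ⟨2 ^ j + 1, j + 1, ?_, ?_⟩ <;> push_cast <;>
    simp only [one_div, inv_pow, pow_succ] <;> field_simp <;> ring

theorem isStdDyadicPair_half_half_add (j : ℕ) :
    IsStdDyadicPair (1 / 2) (1 / 2 + (1 / 2) ^ (j + 1)) := by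
  refine ⟨2 ^ j, j + 1, ?_, ?_⟩ <;> push_cast <;>
    simp only [one_div, inv_pow, pow_succ] <;> field_simp

/-- Admissible numbers of pieces in the definition of `breakCount`. -/
def breakSet (f : Equiv.Perm ℝ) : Set ℕ :=
  {N | 1 ≤ N ∧ ∃ a b : Fin (N + 1) → ℝ,
    a 0 = 0 ∧ a (Fin.last N) = 1 ∧ b 0 = 0 ∧ b (Fin.last N) = 1 ∧
    StrictMono a ∧ StrictMono b ∧
    ∀ i : Fin N, IsStdDyadicPair (a i.castSucc) (a i.succ) ∧
      IsStdDyadicPair (b i.castSucc) (b i.succ) ∧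
      ∃ c d : ℝ, 0 < c ∧ (∀ t ∈ Set.Icc (a i.castSucc) (a i.succ), f t = c * t + d) ∧
        c * a i.castSucc + d = b i.castSucc ∧ c * a i.succ + d = b i.succ}

theorem breakCount_eq {f : Equiv.Perm ℝ} {N : ℕ} (h : N ∈ breakSet f)
    (hmin : ∀ M ∈ breakSet f, N ≤ M) : breakCount f = N :=
  le_antisymm (Nat.sInf_le h) (le_csInf ⟨N, h⟩ hmin)

theorem mem_breakSet {f : Equiv.Perm ℝ} {N : ℕ} (hN : 1 ≤ N) {A B : ℕ → ℝ}
    (hA0 : A 0 = 0) (hA1 : A N = 1) (hB0 : B 0 = 0) (hB1 : B N = 1)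
    (h : ∀ i < N, IsStdDyadicPair (A i) (A (i + 1)) ∧ IsStdDyadicPair (B i) (B (i + 1)) ∧
      ∃ c d : ℝ, 0 < c ∧ (∀ t ∈ Set.Icc (A i) (A (i + 1)), f t = c * t + d) ∧
        c * A i + d = B i ∧ c * A (i + 1) + d = B (i + 1)) : N ∈ breakSet f :=
  ⟨hN, fun i => A i, fun i => B i, hA0, by simpa using hA1, hB0, by simpa using hB1,
    Fin.strictMono_iff_lt_succ.2 fun i => (h i i.2).1.lt,
    Fin.strictMono_iff_lt_succ.2 fun i => (h i i.2).2.1.lt, fun i => h i i.2⟩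

theorem IsStdDyadicPair.sub_le_two_mul {a b : ℝ} (h : IsStdDyadicPair a b) {e : ℕ}
    (hb : b < (1 / 2) ^ e) : (1 / 2) ^ e - a ≤ 2 * ((1 / 2) ^ e - b) := by
  obtain ⟨k, m, rfl, rfl⟩ := h
  have hm : (0 : ℝ) < 2 ^ m := by positivity
  have hem : e ≤ m := by
    by_contra hlt
    have h1 : (1 / 2 : ℝ) ^ e ≤ (1 / 2) ^ m := half_pow_le_half_pow (by omega)
    have h2 : (1 / 2 : ℝ) ^ m ≤ (k + 1) / 2 ^ m := by
      rw [one_div_pow]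
      gcongr
      linarith [k.cast_nonneg (α := ℝ)]
    linarith
  obtain ⟨d, rfl⟩ := Nat.exists_eq_add_of_le hem
  have hP : (1 / 2 : ℝ) ^ e = 2 ^ d / 2 ^ (e + d) := by
    rw [one_div_pow, pow_add]
    field_simp
  rw [hP] at hb ⊢
  rw [div_lt_div_iff_of_pos_right hm] at hb
  have h3 : k + 2 ≤ 2 ^ d := by
    have : k + 1 < 2 ^ d := by exact_mod_cast hb
    omega
  have h4 : (k : ℝ) + 2 ≤ 2 ^ d := by exact_mod_cast h3
  rw [← sub_div, ← sub_div, ← mul_div_assoc]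
  gcongr
  linarith

theorem half_pow_mul_le_sub {N : ℕ} {a : Fin (N + 1) → ℝ} (ha0 : a 0 = 0) (ha : StrictMono a)
    (h : ∀ i : Fin N, IsStdDyadicPair (a i.castSucc) (a i.succ)) {e : ℕ} (i : Fin (N + 1))
    (hi : a i < (1 / 2) ^ e) : (1 / 2) ^ (e + i : ℕ) ≤ (1 / 2) ^ e - a i := by
  induction i using Fin.induction with
  | zero => simp [ha0]
  | succ i ih =>
    have h1 := ih ((ha i.castSucc_lt_succ).trans hi)
    have h2 := (h i).sub_le_two_mul hi
    have h3 : (1 / 2 : ℝ) ^ (e + i.succ : ℕ) = (1 / 2) ^ (e + i.castSucc : ℕ) / 2 := by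
      simp only [Fin.val_succ, Fin.val_castSucc]
      ring
    linarith

theorem x1_pow_mem_breakSet (n : ℕ) : n + 3 ∈ breakSet (x1 ^ n) := by
  refine mem_breakSet (A := fun i => if i = n + 3 then 1 else 1 - (1 / 2) ^ i)
    (B := fun i => if i = 0 then 0 else if i = 1 then 1 / 2 else 1 / 2 + (1 / 2) ^ (n + 4 - i))
    (by omega) (by simp) (by simp) (by simp) ?_ ?_
  · simp only [show n + 3 ≠ 0 by omega, show n + 3 ≠ 1 by omega, if_false,
      show n + 4 - (n + 3) = 1 by omega]
    norm_num
  intro i hi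
  rw [if_neg (show i ≠ n + 3 by omega), if_neg (show i + 1 ≠ 0 by omega)]
  rcases Nat.lt_or_ge i 2 with h2 | h2
  · rw [if_neg (show i + 1 ≠ n + 3 by omega)]
    obtain rfl | rfl : i = 0 ∨ i = 1 := by omega
    · refine ⟨isStdDyadicPair_one_sub 0, ⟨0, 1, by simp, by simp⟩, 1, 0, one_pos, ?_, ?_, ?_⟩
      · intro t ht
        norm_num at ht
        rw [x1_pow_of_le_half n ht.2]
        ring
      · norm_num
      · norm_num
    · rw [if_neg one_ne_zero, if_pos rfl, if_neg (by omega), show n + 4 - (1 + 1) = n + 2 by omega]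
      refine ⟨isStdDyadicPair_one_sub 1, isStdDyadicPair_half_half_add (n + 1), (1 / 2) ^ n,
        1 / 2 - (1 / 2) ^ n * (1 / 2), by positivity, ?_, by ring, by ring⟩
      intro t ht
      norm_num at ht
      rw [x1_pow_of_mem_contracting n ht.1 ht.2]
      ring
  rw [if_neg (show i ≠ 0 by omega), if_neg (show i ≠ 1 by omega),
    if_neg (show i + 1 ≠ 1 by omega)]
  rcases Nat.lt_or_ge i (n + 2) with h3 | h3
  · rw [if_neg (show i + 1 ≠ n + 3 by omega)]
    obtain ⟨k, rfl⟩ : ∃ k, i = k + 2 := ⟨i - 2, by omega⟩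
    obtain ⟨d, rfl⟩ : ∃ d, n = d + 1 + k := ⟨n - 1 - k, by omega⟩
    rw [show d + 1 + k + 4 - (k + 2) = d + 3 by omega,
      show d + 1 + k + 4 - (k + 2 + 1) = d + 2 by omega]
    have hk : (2 : ℝ) ^ k * (1 / 2) ^ k = 1 := by rw [← mul_pow]; norm_num
    refine ⟨isStdDyadicPair_one_sub (k + 2), isStdDyadicPair_half_add (d + 2),
      2 ^ k * (1 / 2) ^ d, 1 / 2 + (1 / 2) ^ (d + 3) - 2 ^ k * (1 / 2) ^ d * (1 - (1 / 2) ^ (k + 2)),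
      by positivity, ?_, by ring, ?_⟩
    · intro t ht
      rw [x1_pow_of_mem_middle d k ht.1 ht.2]
      ring
    · linear_combination (1 / 8) * (1 / 2) ^ d * hk
  · obtain rfl : i = n + 2 := by omega
    rw [if_pos rfl, show n + 4 - (n + 2) = 2 by omega, show n + 4 - (n + 2 + 1) = 1 by omega]
    have hk : (2 : ℝ) ^ n * (1 / 2) ^ n = 1 := by rw [← mul_pow]; norm_num
    refine ⟨isStdDyadicPair_one_sub_one (n + 2), isStdDyadicPair_half_add 1, 2 ^ n,
      1 - 2 ^ n, by positivity, ?_, ?_, by ring⟩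
    · intro t ht
      rw [x1_pow_of_ge n ht.1 ht.2]
      ring
    · linear_combination (-1 / 4) * hk

theorem le_of_mem_breakSet_x1_pow {n : ℕ} (hn : 1 ≤ n) {N : ℕ} (h : N ∈ breakSet (x1 ^ n)) :
    n + 3 ≤ N := by
  obtain ⟨hN, a, b, ha0, ha1, -, -, ha, -, hab⟩ := h
  obtain ⟨M, rfl⟩ : ∃ M, N = M + 1 := ⟨N - 1, by omega⟩
  by_contra hlt
  have h1 := half_pow_mul_le_sub ha0 ha (fun i => (hab i).1) (e := 0) (Fin.last M).castSucc
    (by rw [pow_zero, ← ha1]; exact ha (Fin.castSucc_lt_last _))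
  obtain ⟨-, -, c, d, -, hf, -, -⟩ := hab (Fin.last M)
  rw [Fin.succ_last, ha1] at hf
  have h2 : (1 / 2 : ℝ) ^ (n + 1) ≤ 1 - a (Fin.last M).castSucc := by
    refine le_trans (half_pow_le_half_pow ?_) (by simpa using h1)
    omega
  have h3 : (0 : ℝ) < (1 / 2) ^ (n + 1) := by positivity
  have h4 : (1 / 2 : ℝ) ^ (n + 2) = (1 / 2) ^ (n + 1) / 2 := by ring
  have e1 := hf 1 ⟨by linarith, le_rfl⟩
  have e2 := hf (1 - (1 / 2) ^ (n + 2)) ⟨by linarith, by linarith⟩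
  have e3 := hf (1 - (1 / 2) ^ (n + 1)) ⟨by linarith, by linarith⟩
  have hk : (2 : ℝ) ^ n * (1 / 2) ^ n = 1 := by rw [← mul_pow]; norm_num
  rw [x1_pow_of_ge n (by linarith) le_rfl] at e1
  rw [x1_pow_of_ge n le_rfl (by linarith),
    show 1 - (2 : ℝ) ^ n * (1 - (1 - (1 / 2) ^ (n + 2))) = 3 / 4 by
      linear_combination (-1 / 4) * hk] at e2
  obtain ⟨k, rfl⟩ : ∃ k, n = 0 + 1 + k := ⟨n - 1, by omega⟩
  rw [show 0 + 1 + k + 1 = k + 2 by omega, show 0 + 1 + k + 2 = k + 3 by omega] at *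
  rw [x1_pow_of_mem_middle 0 k le_rfl (by linarith)] at e3
  norm_num at e1 e3
  norm_num at h4 e2
  rw [h4] at e2
  linarith

theorem longElement_mem_breakSet (n : ℕ) : n + 4 ∈ breakSet (longElement n) := by
  refine mem_breakSet
    (A := fun i => if i ≤ n + 2 then 1 / 2 - (1 / 2) ^ (i + 1) else if i = n + 3 then 1 / 2 else 1)
    (B := fun i => if i ≤ n + 1 then 1 / 4 - (1 / 2) ^ (i + 2)
      else if i = n + 2 then 1 / 4 else if i = n + 3 then 1 / 2 else 1)
    (by omega) (by norm_num) (by simp) (by norm_num) (by simp) ?_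
  intro i hi
  have hA (j : ℕ) : IsStdDyadicPair (1 / 2 - (1 / 2) ^ (j + 1)) (1 / 2 - (1 / 2) ^ (j + 1 + 1)) := by
    convert (isStdDyadicPair_one_sub j).half using 1 <;> ring
  have hA' (j : ℕ) : IsStdDyadicPair (1 / 2 - (1 / 2) ^ (j + 1)) (1 / 2) := by
    convert (isStdDyadicPair_one_sub_one j).half using 1; ring
  have hB (j : ℕ) : IsStdDyadicPair (1 / 4 - (1 / 2) ^ (j + 2)) (1 / 4 - (1 / 2) ^ (j + 1 + 2)) := by
    convert (isStdDyadicPair_one_sub j).half.half using 1 <;> ring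
  have hB' (j : ℕ) : IsStdDyadicPair (1 / 4 - (1 / 2) ^ (j + 2)) (1 / 4) := by
    convert (isStdDyadicPair_one_sub_one j).half.half using 1 <;> ring
  have hk : (2 : ℝ) ^ n * (1 / 2) ^ n = 1 := by rw [← mul_pow]; norm_num
  rcases Nat.lt_or_ge i (n + 1) with h1 | h1
  · rw [if_pos (show i ≤ n + 2 by omega), if_pos (show i + 1 ≤ n + 2 by omega),
      if_pos (show i ≤ n + 1 by omega), if_pos (show i + 1 ≤ n + 1 by omega)]
    refine ⟨hA i, hB i, 1 / 2, 0, by norm_num, ?_, by ring, by ring⟩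
    intro t ht
    have h2 : (1 / 2 : ℝ) ^ (i + 1) ≤ (1 / 2) ^ 1 := half_pow_le_half_pow (by omega)
    have h3 : (1 / 2 : ℝ) ^ (n + 2) ≤ (1 / 2) ^ (i + 1 + 1) := half_pow_le_half_pow (by omega)
    rw [longElement_of_le n (by linarith [ht.1]) (by linarith [ht.2])]
    ring
  obtain rfl | rfl | rfl : i = n + 1 ∨ i = n + 2 ∨ i = n + 3 := by omega
  · simp only [show n + 1 ≤ n + 2 by omega, show n + 1 + 1 ≤ n + 2 by omega, le_refl,
      show ¬ n + 1 + 1 ≤ n + 1 by omega, if_true, if_false]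
    refine ⟨hA (n + 1), hB' (n + 1), 1, -1 / 4 + (1 / 2) ^ (n + 3), one_pos, ?_, by ring, by ring⟩
    intro t ht
    rw [longElement_of_mem_isometric n ht.1 ht.2]
    ring
  · simp only [show ¬ n + 2 + 1 ≤ n + 2 by omega, le_refl, show ¬ n + 2 ≤ n + 1 by omega,
      show ¬ n + 2 + 1 ≤ n + 1 by omega, show n + 2 + 1 ≠ n + 2 by omega, if_true, if_false]
    refine ⟨hA' (n + 2), ⟨1, 2, by norm_num, by norm_num⟩, 2 ^ (n + 1), 1 / 2 - 2 ^ n,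
      by positivity, ?_, ?_, by ring⟩
    · intro t ht
      rw [longElement_of_mem_steep n ht.1 ht.2]
      ring
    · linear_combination (-1 / 4) * hk
  · simp only [show ¬ n + 3 ≤ n + 2 by omega, show ¬ n + 3 + 1 ≤ n + 2 by omega,
      show n + 3 + 1 ≠ n + 3 by omega, show ¬ n + 3 ≤ n + 1 by omega,
      show ¬ n + 3 + 1 ≤ n + 1 by omega, show n + 3 ≠ n + 2 by omega,
      show n + 3 + 1 ≠ n + 2 by omega, if_true, if_false]
    refine ⟨⟨1, 1, by norm_num, by norm_num⟩, ⟨1, 1, by norm_num, by norm_num⟩, 1, 0, one_pos,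
      ?_, by ring, by ring⟩
    intro t ht
    rw [longElement_of_ge_half n ht.1 ht.2]
    ring

theorem le_of_mem_breakSet_longElement {n N : ℕ} (h : N ∈ breakSet (longElement n)) :
    n + 4 ≤ N := by
  obtain ⟨-, a, b, ha0, ha1, -, -, ha, -, hab⟩ := h
  obtain ⟨i, hi, hi'⟩ : ∃ i : Fin N, a i.castSucc < 1 / 2 ∧ 1 / 2 ≤ a i.succ := by
    by_contra! hcon
    have hlt (i : Fin (N + 1)) : a i < 1 / 2 := by
      induction i using Fin.induction with
      | zero => rw [ha0]; norm_num
      | succ i ih => exact hcon i ih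
    have := hlt (Fin.last N)
    rw [ha1] at this
    norm_num at this
  have h1 := half_pow_mul_le_sub ha0 ha (fun i => (hab i).1) (e := 1) i.castSucc (by simpa using hi)
  rw [Fin.val_castSucc, pow_one] at h1
  obtain ⟨hstd, -, c, d, -, hf, -, -⟩ := hab i
  have hbig : n + 2 ≤ i := by
    by_contra hlt
    have h2 : (1 / 2 : ℝ) ^ (n + 2) ≤ (1 / 2) ^ (1 + i : ℕ) := half_pow_le_half_pow (by omega)
    have h3 : (0 : ℝ) < (1 / 2) ^ (n + 2) := by positivity
    have h4 : (1 / 2 : ℝ) ^ (n + 3) = (1 / 2) ^ (n + 2) / 2 := by ring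
    have h5 : (1 / 2 : ℝ) ^ (n + 2) ≤ (1 / 2) ^ 2 := half_pow_le_half_pow (by omega)
    have e1 := hf (1 / 2) ⟨by linarith, by linarith⟩
    have e2 := hf (1 / 2 - (1 / 2) ^ (n + 3)) ⟨by linarith, by linarith⟩
    have e3 := hf (1 / 2 - (1 / 2) ^ (n + 2)) ⟨by linarith, by linarith⟩
    norm_num at h5
    rw [longElement_of_ge_half n le_rfl (by norm_num)] at e1
    rw [longElement_of_mem_isometric n (by linarith) le_rfl, h4] at e2
    rw [longElement_of_mem_isometric n le_rfl (by linarith), h4] at e3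
    linarith
  have hlast : i.succ ≠ Fin.last N := by
    intro hlast
    rw [hlast, ha1] at hstd
    obtain ⟨k, m, hk, hm⟩ := hstd
    have hpos : (0 : ℝ) < 2 ^ m := by positivity
    rw [eq_div_iff hpos.ne', one_mul] at hm
    have hk0 : k = 0 := by
      rw [hk, div_lt_iff₀ hpos, hm] at hi
      have : (k : ℝ) < 1 := by linarith
      exact_mod_cast Nat.lt_one_iff.1 (by exact_mod_cast this)
    rw [hk0, Nat.cast_zero, zero_div, ← ha0] at hk
    have := congrArg Fin.val (ha.injective hk)
    simp at this
    omega
  have : (i : ℕ) + 1 ≠ N := fun h => hlast (Fin.ext (by simpa using h))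
  omega

end BreakCount

section Lengths

theorem wordLength_x1_pow (n : ℕ) : wordLength (x1 ^ n) = n := by
  have hrep : ((List.replicate n Letter.b).map Letter.toPerm).prod = x1 ^ n := by
    simp [Letter.toPerm]
  rw [wordLength_eq hrep, List.length_replicate]
  intro l hl
  rw [List.length_replicate]
  have h1 := toUnit_lineProd l ((n + 1 : ℕ) : ℝ)
  have h2 := toUnit_natCast 1
  have hk : (2 : ℝ) ^ n * (1 / 2) ^ n = 1 := by rw [← mul_pow]; norm_num
  rw [hl, toUnit_natCast, x1_pow_of_ge n le_rfl (by simp),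
    show 1 - (2 : ℝ) ^ n * (1 - (1 - (1 / 2) ^ (n + 1 + 1))) = 1 - (1 / 2) ^ (1 + 1) by
      linear_combination (-1 / 4) * hk, ← h2] at h1
  have h3 := sub_length_le_lineProd l ((n + 1 : ℕ) : ℝ)
  rw [toUnit_injective h1] at h3
  push_cast at h3
  have h4 : (n : ℝ) ≤ l.length := by linarith
  exact_mod_cast h4

theorem wordLength_longElement (n : ℕ) : wordLength (longElement n) = 4 * n + 4 := by
  have hrep : (([Letter.a, Letter.a] ++ (List.replicate n [Letter.b, Letter.aInv]).flatten ++
      [Letter.bInv] ++ (List.replicate n [Letter.a, Letter.bInv]).flatten ++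
      [Letter.aInv]).map Letter.toPerm).prod = longElement n := by
    simp [Letter.toPerm, longElement, List.map_flatten, List.prod_flatten, pow_two, mul_assoc]
  rw [wordLength_eq hrep]
  · simp
    ring
  intro l hl
  have hneg (j : ℕ) : toUnit (-(1 / 2) ^ (j + 1)) = 1 / 2 - (1 / 2) ^ (j + 3) := by
    have h : (1 / 2 : ℝ) ^ (j + 1) ≤ (1 / 2) ^ 0 := half_pow_le_half_pow (by omega)
    have h' : (0 : ℝ) < (1 / 2) ^ (j + 1) := by positivity
    rw [toUnit_of_mem_Ico_neg_one (by linarith) (by linarith)]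
    ring
  have hneg' (j : ℕ) : toUnit (-1 - (1 / 2) ^ (j + 1)) = toUnit (-(1 / 2) ^ (j + 1)) / 2 := by
    rw [← toUnit_sub_one_of_neg (by simp)]
    ring_nf
  have hact (t : ℝ) : toUnit (lineProd l t) = longElement n (toUnit t) := by
    rw [toUnit_lineProd, hl]
  refine le_trans (le_of_eq ?_) (four_mul_add_four_le_length (n := n) ?_ ?_ ?_)
  · simp
    ring
  · apply toUnit_injective
    rw [hact, toUnit_zero, longElement_of_ge_half n le_rfl (by norm_num)]
  · apply toUnit_injective
    have h : (1 / 2 : ℝ) ^ (n + 3) ≤ (1 / 2) ^ (n + 2) := half_pow_le_half_pow (by omega)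
    rw [hact, hneg, longElement_of_mem_isometric n (by linarith) le_rfl,
      toUnit_of_mem_Ico_neg_one le_rfl (by norm_num)]
    ring
  · intro j hj
    apply toUnit_injective
    have h : (1 / 2 : ℝ) ^ (n + 2) ≤ (1 / 2) ^ (j + 3) := half_pow_le_half_pow (by omega)
    have h' : (1 / 2 : ℝ) ^ (j + 3) ≤ (1 / 2) ^ 1 := half_pow_le_half_pow (by omega)
    rw [hact, hneg', hneg, longElement_of_le n (by linarith) (by linarith)]

end Lengths

theorem length_bounds_sharp (n : ℕ) (hn : 1 ≤ n) :
    (wordLength (x1 ^ n) : ℤ) = (breakCount (x1 ^ n) : ℤ) - 3 ∧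
    (wordLength (x0 ^ 2 * (x1 * x0⁻¹) ^ n * x1⁻¹ * (x0 * x1⁻¹) ^ n * x0⁻¹) : ℤ) =
      4 * (breakCount (x0 ^ 2 * (x1 * x0⁻¹) ^ n * x1⁻¹ * (x0 * x1⁻¹) ^ n * x0⁻¹) : ℤ) - 12 := by
  change _ ∧ (wordLength (longElement n) : ℤ) = 4 * (breakCount (longElement n) : ℤ) - 12
  rw [wordLength_x1_pow, wordLength_longElement,
    breakCount_eq (x1_pow_mem_breakSet n) fun M => le_of_mem_breakSet_x1_pow hn,
    breakCount_eq (longElement_mem_breakSet n) fun M => le_of_mem_breakSet_longElement]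
  push_cast
  constructor <;> ring

end
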